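/- Let AT be an argumentation theory and A an argument from AT. If A is circular, then A is not minimal. -/

import Mathlib

/-- A rule over the language `L`: a finite list of premises and a conclusion. -/
structure ArgRule (L : Type) where
  prems : List L
  concl : L

/-- An argumentation theory: a set of rules and a knowledge base. -/
structure ArgTheory (L : Type) where
  rules : Set (ArgRule L)
  kb : Set L

/-- Raw argument structures: either an element of the knowledge base, or an
application of a rule to a list of sub-arguments. -/
inductive Arg (L : Type) : Type
  | atom (φ : L) : Arg L
  | node (children : List (Arg L)) (φ : L) : Arg L

namespace Arg

variable {L : Type}

/-- The conclusion of an argument. -/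
def Conc : Arg L → L
  | .atom φ => φ
  | .node _ φ => φ

/-- The premises (grounds) of an argument. -/
def Prem : Arg L → Set L
  | .atom φ => {φ}
  | .node cs _ => cs.attach.foldr (fun c acc => Prem c.1 ∪ acc) ∅
decreasing_by have := List.sizeOf_lt_of_mem c.2; simp_wf; omega

/-- The set of rules used in an argument. -/
def Rules : Arg L → Set (ArgRule L)
  | .atom _ => ∅
  | .node cs φ =>
      insert ⟨cs.map Conc, φ⟩ (cs.attach.foldr (fun c acc => Rules c.1 ∪ acc) ∅)
decreasing_by have := List.sizeOf_lt_of_mem c.2; simp_wf; omega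

/-- The sub-arguments of an argument (including the argument itself). -/
def Sub : Arg L → Set (Arg L)
  | .atom φ => {.atom φ}
  | .node cs φ => insert (.node cs φ) (cs.attach.foldr (fun c acc => Sub c.1 ∪ acc) ∅)
decreasing_by have := List.sizeOf_lt_of_mem c.2; simp_wf; omega

/-- The top rule of an argument (undefined for atomic arguments). -/
def TopRule : Arg L → Option (ArgRule L)
  | .atom _ => none
  | .node cs φ => some ⟨cs.map Conc, φ⟩

/-- `A.IsArg AT` holds when `A` is a genuine argument of the theory `AT`. -/
inductive IsArg (AT : ArgTheory L) : Arg L → Prop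
  | atom {φ : L} : φ ∈ AT.kb → IsArg AT (.atom φ)
  | node {cs : List (Arg L)} {φ : L} :
      (∀ c ∈ cs, IsArg AT c) →
      (⟨cs.map Conc, φ⟩ : ArgRule L) ∈ AT.rules →
      IsArg AT (.node cs φ)

end Arg

/-- `Infers P R p` (written `P ⊢_R p`): `p` is in the closure of `P` under the
rules `R`, i.e. in the least set containing `P` and closed under `R`. -/
inductive Infers (P : Set L) (R : Set (ArgRule L)) : L → Prop
  | base {p : L} : p ∈ P → Infers P R p
  | step {r : ArgRule L} : r ∈ R → (∀ q ∈ r.prems, Infers P R q) →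
      Infers P R r.concl

namespace Arg

variable {L : Type}

/-- An argument `(G, R, p)` is minimal if no strict subset `G'` of `G` has
`G' ⊢_R p` and no strict subset `R'` of `R` has `G ⊢_{R'} p`. -/
def Minimal (A : Arg L) : Prop :=
  (¬ ∃ G' : Set L, G' ⊂ A.Prem ∧ Infers G' A.Rules A.Conc) ∧
  (¬ ∃ R' : Set (ArgRule L), R' ⊂ A.Rules ∧ Infers A.Prem R' A.Conc)

/-- An argument is regular if no two distinct sub-arguments share a conclusion. -/
def Regular (A : Arg L) : Prop :=
  ¬ ∃ A₁ ∈ A.Sub, ∃ A₂ ∈ A.Sub, A₁ ≠ A₂ ∧ A₁.Conc = A₂.Conc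

/-- An argument is circular if it has distinct sub-arguments with the same
conclusion, one of which is a sub-argument of the other. -/
def Circular (A : Arg L) : Prop :=
  ∃ A₁ ∈ A.Sub, ∃ A₂ ∈ A.Sub, A₁ ≠ A₂ ∧ A₁.Conc = A₂.Conc ∧ A₁ ∈ A₂.Sub

/-- An argument is redundant if it has distinct sub-arguments with the same
conclusion, neither of which is a sub-argument of the other. -/
def Redundant (A : Arg L) : Prop :=
  ∃ A₁ ∈ A.Sub, ∃ A₂ ∈ A.Sub, A₁ ≠ A₂ ∧ A₁.Conc = A₂.Conc ∧
    A₁ ∉ A₂.Sub ∧ A₂ ∉ A₁.Sub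

end Arg

/-- `InfersIn P R n p`: `p` is obtained from `P` by at most `n` rounds of applying rules in `R`. -/
def InfersIn {L : Type} (P : Set L) (R : Set (ArgRule L)) : ℕ → L → Prop
  | 0, p => p ∈ P
  | n + 1, p => InfersIn P R n p ∨ ∃ r ∈ R, r.concl = p ∧ ∀ q ∈ r.prems, InfersIn P R n q

namespace InfersIn

variable {L : Type} {P : Set L} {R : Set (ArgRule L)} {m n : ℕ} {p : L}

theorem mono (hmn : m ≤ n) (h : InfersIn P R m p) : InfersIn P R n p := by
  induction hmn with
  | refl => exact h
  | step _ ih => exact Or.inl ih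

/-- The rules of `R` whose conclusion is obtained strictly later than all of their premises. -/
def progressive (P : Set L) (R : Set (ArgRule L)) : Set (ArgRule L) :=
  {r ∈ R | ∃ n, (∀ q ∈ r.prems, InfersIn P R n q) ∧ ¬ InfersIn P R n r.concl}

theorem infers_progressive (h : InfersIn P R n p) : Infers P (progressive P R) p := by
  induction n generalizing p with
  | zero => exact .base h
  | succ n ih =>
    by_cases hn : InfersIn P R n p
    · exact ih hn
    · obtain ⟨r, hr, rfl, hq⟩ := h.resolve_left hn
      exact .step ⟨hr, n, hq, hn⟩ fun q hqr => ih (hq q hqr)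

end InfersIn

namespace Arg

variable {L : Type}

theorem induction_on_children {motive : Arg L → Prop} (atom : ∀ φ, motive (.atom φ))
    (node : ∀ cs φ, (∀ c ∈ cs, motive c) → motive (.node cs φ)) : ∀ A, motive A
  | .atom φ => atom φ
  | .node cs φ => node cs φ fun c _ => induction_on_children atom node c

theorem mem_foldr_attach_union {α β : Type} (f : α → Set β) (l : List α) (x : β) :
    x ∈ l.attach.foldr (fun c acc => f c.1 ∪ acc) ∅ ↔ ∃ c ∈ l, x ∈ f c := by
  rw [List.foldr_attach (l := l) (f := fun c acc => f c ∪ acc)]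
  induction l with
  | nil => simp
  | cons a l ih => simp [ih]

theorem mem_Prem_node {cs : List (Arg L)} {φ x : L} :
    x ∈ (node cs φ).Prem ↔ ∃ c ∈ cs, x ∈ c.Prem := by
  rw [Prem, mem_foldr_attach_union]

theorem mem_Rules_node {cs : List (Arg L)} {φ : L} {r : ArgRule L} :
    r ∈ (node cs φ).Rules ↔ r = ⟨cs.map Conc, φ⟩ ∨ ∃ c ∈ cs, r ∈ c.Rules := by
  rw [Rules, Set.mem_insert_iff, mem_foldr_attach_union]

theorem mem_Sub_node {cs : List (Arg L)} {φ : L} {B : Arg L} :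
    B ∈ (node cs φ).Sub ↔ B = node cs φ ∨ ∃ c ∈ cs, B ∈ c.Sub := by
  rw [Sub, Set.mem_insert_iff, mem_foldr_attach_union]

theorem Rules_subset_of_mem_Sub {A B : Arg L} (h : B ∈ A.Sub) : B.Rules ⊆ A.Rules := by
  induction A using induction_on_children with
  | atom φ =>
    rw [Sub, Set.mem_singleton_iff] at h
    rw [h]
  | node cs φ ih =>
    obtain rfl | ⟨c, hc, hB⟩ := mem_Sub_node.1 h
    · rfl
    · exact fun r hr => mem_Rules_node.2 (.inr ⟨c, hc, ih c hc hB hr⟩)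

theorem infersIn_sizeOf {P : Set L} {R : Set (ArgRule L)} {A : Arg L} (hP : A.Prem ⊆ P)
    (hR : A.Rules ⊆ R) : InfersIn P R (sizeOf A) A.Conc := by
  induction A using induction_on_children with
  | atom φ =>
    refine InfersIn.mono (Nat.zero_le _) (hP ?_)
    rw [Prem]
    rfl
  | node cs φ ih =>
    refine InfersIn.mono (m := sizeOf cs + 1) (by simp)
      (.inr ⟨⟨cs.map Conc, φ⟩, hR (mem_Rules_node.2 (.inl rfl)), rfl, ?_⟩)
    intro q hq
    obtain ⟨c, hc, rfl⟩ := List.mem_map.1 hq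
    exact (ih c hc (fun x hx => hP (mem_Prem_node.2 ⟨c, hc, hx⟩))
      (fun r hr => hR (mem_Rules_node.2 (.inr ⟨c, hc, hr⟩)))).mono (List.sizeOf_lt_of_mem hc).le

/-- If all rules of `A` are progressive, then proper sub-arguments of `A` have conclusions that
are obtained strictly earlier than that of `A`. -/
theorem exists_infersIn_of_mem_Sub {P : Set L} {R : Set (ArgRule L)} {A B : Arg L}
    (hA : A.Rules ⊆ InfersIn.progressive P R) (hB : B ∈ A.Sub) (hne : B ≠ A) :
    ∃ n, InfersIn P R n B.Conc ∧ ¬ InfersIn P R n A.Conc := by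
  induction A using induction_on_children with
  | atom φ =>
    rw [Sub] at hB
    exact absurd hB hne
  | node cs φ ih =>
    obtain ⟨c, hc, hBc⟩ := (mem_Sub_node.1 hB).resolve_left hne
    obtain ⟨-, n, hn, hφ⟩ := hA (mem_Rules_node.2 (.inl rfl))
    have hcn : InfersIn P R n c.Conc := hn _ (List.mem_map_of_mem hc)
    refine ⟨n, ?_, hφ⟩
    by_cases hcB : B = c
    · exact hcB ▸ hcn
    · obtain ⟨m, hm, hcm⟩ :=
        ih c hc (fun r hr => hA (mem_Rules_node.2 (.inr ⟨c, hc, hr⟩))) hBc hcB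
      exact hm.mono (le_of_not_ge fun hnm => hcm (hcn.mono hnm))

theorem Minimal.rules_subset_progressive {A : Arg L} (h : A.Minimal) :
    A.Rules ⊆ InfersIn.progressive A.Prem A.Rules := by
  by_contra hsub
  exact h.2 ⟨_, ⟨fun _ hr => hr.1, hsub⟩,
    (infersIn_sizeOf subset_rfl subset_rfl).infers_progressive⟩

end Arg

/-- A circular argument is not minimal. -/
theorem stmt_9 {L : Type} (AT : ArgTheory L) (A : Arg L) (hA : A.IsArg AT)
    (hcirc : A.Circular) : ¬ A.Minimal := by
  intro hmin
  obtain ⟨A₁, -, A₂, hA₂, hne, hconc, hsub⟩ := hcirc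
  obtain ⟨n, hn, hn'⟩ := Arg.exists_infersIn_of_mem_Sub
    ((Arg.Rules_subset_of_mem_Sub hA₂).trans hmin.rules_subset_progressive) hsub hne
  exact hn' (hconc ▸ hn)
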